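/- Let M° = (S,A,s_init,H,T°,R°) be a finite episodic MDP and η ∈ [0,1]. The policy ρ returned by robust dynamic programming on (M°,η) is a robust policy: inf_{M ∈ P(M°,η)} V^ρ_M = max_ψ inf_{M ∈ P(M°,η)} V^ψ_M, where the maximum ranges over all abstract policies ψ : {1,…,H}×S → A; moreover this common value equals Ṽ_1(s_init). -/

import Mathlib

/-- A finite episodic MDP: finite state space `S`, finite action space `A`,
initial state, horizon `H`, step-indexed transition probabilities and rewards
(steps are indexed `1, …, H`). -/
structure FinMDP (S A : Type) [Fintype S] [Fintype A] where
  H : ℕ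
  init : S
  T : ℕ → S → A → S → ℝ
  R : ℕ → S → A → ℝ
  T_nonneg : ∀ h s a s', 0 ≤ T h s a s'
  T_sum : ∀ h s a, ∑ s', T h s a s' = 1
  R_nonneg : ∀ h s a, 0 ≤ R h s a
  R_le_one : ∀ h s a, R h s a ≤ 1

/-- Auxiliary backward recursion: `valAux M ψ k` is the value function with `k`
steps remaining, i.e. at step `h = M.H + 1 - k`. -/
noncomputable def valAux {S A : Type} [Fintype S] [Fintype A]
    (M : FinMDP S A) (ψ : ℕ → S → A) : ℕ → S → ℝ
  | 0, _ => 0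
  | k + 1, s =>
      M.R (M.H - k) s (ψ (M.H - k) s)
        + ∑ s', M.T (M.H - k) s (ψ (M.H - k) s) s' * valAux M ψ k s'

/-- `val M ψ h s` is the value function `V^ψ_{M,h}(s)` of the abstract policy `ψ`:
`V^ψ_{M,H+1} = 0` and `V^ψ_{M,h}(s) = R_h(s,ψ_h(s)) + ∑ s', T_h(s'|s,ψ_h(s)) V^ψ_{M,h+1}(s')`. -/
noncomputable def val {S A : Type} [Fintype S] [Fintype A]
    (M : FinMDP S A) (ψ : ℕ → S → A) (h : ℕ) (s : S) : ℝ :=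
  valAux M ψ (M.H + 1 - h) s

/-- `M'` is an η-perturbation of `M`: same horizon and initial state, and there is a
noise kernel `ξ` with `ξ_h(a|s,a) ≥ 1-η` realizing `M'`'s transitions and rewards as
action-perturbed versions of `M`'s on every step `h ∈ {1,…,H}`. -/
def IsPerturbation {S A : Type} [Fintype S] [Fintype A] (η : ℝ)
    (M M' : FinMDP S A) : Prop :=
  M'.H = M.H ∧ M'.init = M.init ∧
  ∃ ξ : ℕ → S → A → A → ℝ,
    ∀ h ∈ Finset.Icc 1 M.H, ∀ (s : S) (a : A),
      (∀ a', 0 ≤ ξ h s a a') ∧ (∑ a', ξ h s a a') = 1 ∧ 1 - η ≤ ξ h s a a ∧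
      (∀ s', M'.T h s a s' = ∑ a', M.T h s a' s' * ξ h s a a') ∧
      M'.R h s a = ∑ a', M.R h s a' * ξ h s a a'

/-- Auxiliary robust dynamic programming recursion: `rdpAux M η k` is the robust
value function with `k` steps remaining, i.e. at step `h = M.H + 1 - k`. -/
noncomputable def rdpAux {S A : Type} [Fintype S] [Fintype A] [Nonempty A]
    (M : FinMDP S A) (η : ℝ) : ℕ → S → ℝ
  | 0, _ => 0
  | k + 1, s =>
      (1 - η) * (Finset.univ.sup' Finset.univ_nonempty (fun a : A =>
          M.R (M.H - k) s a + ∑ s', M.T (M.H - k) s a s' * rdpAux M η k s'))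
      + η * (Finset.univ.inf' Finset.univ_nonempty (fun a : A =>
          M.R (M.H - k) s a + ∑ s', M.T (M.H - k) s a s' * rdpAux M η k s'))

/-- `rdpV M η h s` is the robust value function `Ṽ_h(s)` computed by robust dynamic
programming: `Ṽ_{H+1} = 0` and `Ṽ_h(s) = (1-η) max_a Q̃_h(s,a) + η min_a Q̃_h(s,a)`. -/
noncomputable def rdpV {S A : Type} [Fintype S] [Fintype A] [Nonempty A]
    (M : FinMDP S A) (η : ℝ) (h : ℕ) (s : S) : ℝ :=
  rdpAux M η (M.H + 1 - h) s

/-- `rdpQ M η h s a = Q̃_h(s,a) = R_h(s,a) + ∑ s', T_h(s'|s,a) Ṽ_{h+1}(s')`. -/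
noncomputable def rdpQ {S A : Type} [Fintype S] [Fintype A] [Nonempty A]
    (M : FinMDP S A) (η : ℝ) (h : ℕ) (s : S) (a : A) : ℝ :=
  M.R h s a + ∑ s', M.T h s a s' * rdpV M η (h + 1) s'

theorem valAux_nonneg {S A : Type} [Fintype S] [Fintype A]
    (M : FinMDP S A) (ψ : ℕ → S → A) (k : ℕ) : ∀ s, 0 ≤ valAux M ψ k s := by
  induction k with
  | zero => intro s; simp [valAux]
  | succ k ih =>
    intro s
    rw [valAux]
    exact add_nonneg (M.R_nonneg _ _ _)
      (Finset.sum_nonneg fun s' _ => mul_nonneg (M.T_nonneg _ _ _ _) (ih s'))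

theorem exists_minimizer {S A : Type} [Fintype S] [Fintype A] [Nonempty A]
    (M : FinMDP S A) (η : ℝ) : ∃ b : ℕ → S → A, ∀ h s a,
      rdpQ M η h s (b h s) ≤ rdpQ M η h s a := by
  have : ∀ h s, ∃ b, ∀ a, rdpQ M η h s b ≤ rdpQ M η h s a := fun h s =>
    Finite.exists_min (fun a => rdpQ M η h s a)
  choose b hb using this
  exact ⟨b, hb⟩

/-- The worst-case perturbation. -/
noncomputable def advMDP {S A : Type} [Fintype S] [Fintype A]
    (M : FinMDP S A) (η : ℝ) (h0 : 0 ≤ η) (h1 : η ≤ 1) (b : ℕ → S → A) : FinMDP S A where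
  H := M.H
  init := M.init
  T h s a s' := (1 - η) * M.T h s a s' + η * M.T h s (b h s) s'
  R h s a := (1 - η) * M.R h s a + η * M.R h s (b h s)
  T_nonneg h s a s' := add_nonneg (mul_nonneg (by linarith) (M.T_nonneg _ _ _ _))
    (mul_nonneg h0 (M.T_nonneg _ _ _ _))
  T_sum h s a := by
    rw [Finset.sum_add_distrib, ← Finset.mul_sum, ← Finset.mul_sum, M.T_sum, M.T_sum]; ring
  R_nonneg h s a := add_nonneg (mul_nonneg (by linarith) (M.R_nonneg _ _ _))
    (mul_nonneg h0 (M.R_nonneg _ _ _))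
  R_le_one h s a := by
    have e1 := mul_le_mul_of_nonneg_left (M.R_le_one h s a) (by linarith : 0 ≤ 1 - η)
    have e2 := mul_le_mul_of_nonneg_left (M.R_le_one h s (b h s)) h0
    linarith

theorem advMDP_isPerturbation {S A : Type} [Fintype S] [Fintype A]
    (M : FinMDP S A) (η : ℝ) (h0 : 0 ≤ η) (h1 : η ≤ 1) (b : ℕ → S → A) :
    IsPerturbation η M (advMDP M η h0 h1 b) := by
  classical
  refine ⟨rfl, rfl, fun h s a a' =>
    (1 - η) * (if a' = a then 1 else 0) + η * (if a' = b h s then 1 else 0), ?_⟩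
  intro h _ s a
  have key : ∀ f : A → ℝ, ∑ a', f a' *
      ((1 - η) * (if a' = a then 1 else 0) + η * (if a' = b h s then 1 else 0))
      = (1 - η) * f a + η * f (b h s) := by
    intro f
    simp [mul_add, Finset.sum_add_distrib, mul_comm]
  refine ⟨?_, ?_, ?_, ?_, ?_⟩
  · intro a'
    have : 0 ≤ 1 - η := by linarith
    positivity
  · have := key (fun _ => 1)
    simp only [one_mul] at this
    rw [this]; ring
  · have : 0 ≤ η * (if a = b h s then (1 : ℝ) else 0) := by positivity
    simp only [if_true]
    linarith
  · intro s'
    exact (key (fun a' => M.T h s a' s')).symm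
  · exact (key (fun a' => M.R h s a')).symm

theorem rdpQ_eq {S A : Type} [Fintype S] [Fintype A] [Nonempty A]
    (M : FinMDP S A) (η : ℝ) (k : ℕ) (hk : k ≤ M.H) (s : S) (a : A) :
    rdpQ M η (M.H - k) s a
      = M.R (M.H - k) s a + ∑ s', M.T (M.H - k) s a s' * rdpAux M η k s' := by
  have : M.H + 1 - (M.H - k + 1) = k := by omega
  simp only [rdpQ, rdpV, this]

theorem rdpAux_succ {S A : Type} [Fintype S] [Fintype A] [Nonempty A]
    (M : FinMDP S A) (η : ℝ) (k : ℕ) (hk : k ≤ M.H) (s : S) (a b : A)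
    (ha : ∀ a', rdpQ M η (M.H - k) s a' ≤ rdpQ M η (M.H - k) s a)
    (hb : ∀ a', rdpQ M η (M.H - k) s b ≤ rdpQ M η (M.H - k) s a') :
    rdpAux M η (k + 1) s
      = (1 - η) * rdpQ M η (M.H - k) s a + η * rdpQ M η (M.H - k) s b := by
  rw [rdpAux]
  simp only [← rdpQ_eq M η k hk]
  congr 2
  · exact le_antisymm (Finset.sup'_le _ _ fun a' _ => ha a')
      (Finset.le_sup' (fun a' => rdpQ M η (M.H - k) s a') (Finset.mem_univ a))
  · exact le_antisymm (Finset.inf'_le (fun a' => rdpQ M η (M.H - k) s a') (Finset.mem_univ b))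
      (Finset.le_inf' _ _ fun a' _ => hb a')

theorem adv_le {S A : Type} [Fintype S] [Fintype A] [Nonempty A]
    (M : FinMDP S A) (η : ℝ) (h0 : 0 ≤ η) (h1 : η ≤ 1) (b : ℕ → S → A)
    (hb : ∀ h s a, rdpQ M η h s (b h s) ≤ rdpQ M η h s a)
    (ψ : ℕ → S → A) (k : ℕ) : k ≤ M.H → ∀ s,
      valAux (advMDP M η h0 h1 b) ψ k s ≤ rdpAux M η k s := by
  induction k with
  | zero => intro _ s; simp [valAux, rdpAux]
  | succ k ih =>
    intro hk s
    have hk' : k ≤ M.H := by omega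
    obtain ⟨a, ha⟩ := Finite.exists_max (fun a => rdpQ M η (M.H - k) s a)
    rw [rdpAux_succ M η k hk' s a (b (M.H - k) s) ha (hb _ s), valAux]
    have hH : (advMDP M η h0 h1 b).H = M.H := rfl
    rw [hH]
    set c := ψ (M.H - k) s
    have step : ∑ s', (advMDP M η h0 h1 b).T (M.H - k) s c s' *
          valAux (advMDP M η h0 h1 b) ψ k s'
        ≤ ∑ s', (advMDP M η h0 h1 b).T (M.H - k) s c s' * rdpAux M η k s' :=
      Finset.sum_le_sum fun s' _ =>
        mul_le_mul_of_nonneg_left (ih hk' s') ((advMDP M η h0 h1 b).T_nonneg _ _ _ _)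
    have expand : (advMDP M η h0 h1 b).R (M.H - k) s c
          + ∑ s', (advMDP M η h0 h1 b).T (M.H - k) s c s' * rdpAux M η k s'
        = (1 - η) * rdpQ M η (M.H - k) s c + η * rdpQ M η (M.H - k) s (b (M.H - k) s) := by
      rw [rdpQ_eq M η k hk', rdpQ_eq M η k hk']
      simp only [advMDP, add_mul, Finset.sum_add_distrib, mul_assoc, ← Finset.mul_sum]
      ring
    have := mul_le_mul_of_nonneg_left (ha c) (by linarith : 0 ≤ 1 - η)
    linarith

theorem le_val {S A : Type} [Fintype S] [Fintype A] [Nonempty A]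
    (M : FinMDP S A) (η : ℝ) (b : ℕ → S → A)
    (hb : ∀ h s a, rdpQ M η h s (b h s) ≤ rdpQ M η h s a)
    (ρ : ℕ → S → A)
    (hρ : ∀ h ∈ Finset.Icc 1 M.H, ∀ (s : S) (a : A),
      rdpQ M η h s a ≤ rdpQ M η h s (ρ h s))
    (M' : FinMDP S A) (hM' : IsPerturbation η M M') (k : ℕ) : k ≤ M.H → ∀ s,
      rdpAux M η k s ≤ valAux M' ρ k s := by
  obtain ⟨hH, -, ξ, hξ⟩ := hM'
  induction k with
  | zero => intro _ s; simp [valAux, rdpAux]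
  | succ k ih =>
    intro hk s
    have hk' : k ≤ M.H := by omega
    have hmem : M.H - k ∈ Finset.Icc 1 M.H := by
      rw [Finset.mem_Icc]; omega
    rw [rdpAux_succ M η k hk' s (ρ (M.H - k) s) (b (M.H - k) s) (hρ _ hmem s) (hb _ s),
      valAux, hH]
    set c := ρ (M.H - k) s
    set m := rdpQ M η (M.H - k) s (b (M.H - k) s) with hm
    obtain ⟨x0, x1, xc, xT, xR⟩ := hξ _ hmem s c
    have step : ∑ s', M'.T (M.H - k) s c s' * rdpAux M η k s'
        ≤ ∑ s', M'.T (M.H - k) s c s' * valAux M' ρ k s' :=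
      Finset.sum_le_sum fun s' _ =>
        mul_le_mul_of_nonneg_left (ih hk' s') (M'.T_nonneg _ _ _ _)
    have expand : M'.R (M.H - k) s c + ∑ s', M'.T (M.H - k) s c s' * rdpAux M η k s'
        = ∑ a', ξ (M.H - k) s c a' * rdpQ M η (M.H - k) s a' := by
      simp only [rdpQ_eq M η k hk', xR, xT, mul_add, Finset.sum_add_distrib, Finset.sum_mul,
        Finset.mul_sum]
      rw [Finset.sum_comm]
      congr 1
      · exact Finset.sum_congr rfl fun _ _ => mul_comm _ _
      · exact Finset.sum_congr rfl fun _ _ => Finset.sum_congr rfl fun _ _ => by ring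
    have single : ξ (M.H - k) s c c * (rdpQ M η (M.H - k) s c - m)
        ≤ ∑ a', ξ (M.H - k) s c a' * (rdpQ M η (M.H - k) s a' - m) :=
      Finset.single_le_sum
        (f := fun a' => ξ (M.H - k) s c a' * (rdpQ M η (M.H - k) s a' - m))
        (fun a' _ => mul_nonneg (x0 a') (sub_nonneg.2 (hb _ s a'))) (Finset.mem_univ c)
    simp only [mul_sub, Finset.sum_sub_distrib, ← Finset.sum_mul, x1] at single
    have := mul_le_mul_of_nonneg_right xc (sub_nonneg.2 (hb (M.H - k) s c))
    rw [← hm] at this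
    linarith

/-- The greedy policy `ρ` returned by robust dynamic programming is a
robust policy: `inf_{M ∈ P(M₀,η)} V^ρ_M` is the greatest value of
`ψ ↦ inf_{M ∈ P(M₀,η)} V^ψ_M` over all abstract policies `ψ`, and this common value
equals `Ṽ_1(s_init)`. Here `V^ψ_M = V^ψ_{M,1}(s_init)`. -/
theorem stmt_5 {S A : Type} [Fintype S] [Fintype A] [Nonempty S] [Nonempty A]
    (M₀ : FinMDP S A) (η : ℝ) (hη : η ∈ Set.Icc (0 : ℝ) 1)
    (ρ : ℕ → S → A)
    (hρ : ∀ h ∈ Finset.Icc 1 M₀.H, ∀ (s : S) (a : A),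
      rdpQ M₀ η h s a ≤ rdpQ M₀ η h s (ρ h s)) :
    IsGreatest
      {v : ℝ | ∃ ψ : ℕ → S → A,
        v = ⨅ M : {M : FinMDP S A // IsPerturbation η M₀ M}, val M.1 ψ 1 M.1.init}
      (⨅ M : {M : FinMDP S A // IsPerturbation η M₀ M}, val M.1 ρ 1 M.1.init)
    ∧ (⨅ M : {M : FinMDP S A // IsPerturbation η M₀ M}, val M.1 ρ 1 M.1.init)
        = rdpV M₀ η 1 M₀.init := by
  obtain ⟨h0, h1⟩ := hη
  obtain ⟨b, hb⟩ := exists_minimizer M₀ η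
  let N : {M : FinMDP S A // IsPerturbation η M₀ M} :=
    ⟨advMDP M₀ η h0 h1 b, advMDP_isPerturbation M₀ η h0 h1 b⟩
  have upper : ∀ ψ : ℕ → S → A,
      (⨅ M : {M : FinMDP S A // IsPerturbation η M₀ M}, val M.1 ψ 1 M.1.init)
        ≤ rdpV M₀ η 1 M₀.init := by
    intro ψ
    refine (ciInf_le ⟨0, ?_⟩ N).trans ?_
    · rintro _ ⟨M, rfl⟩
      exact valAux_nonneg _ _ _ _
    · exact adv_le M₀ η h0 h1 b hb ψ M₀.H le_rfl M₀.init
  have lower : rdpV M₀ η 1 M₀.init ≤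
      ⨅ M : {M : FinMDP S A // IsPerturbation η M₀ M}, val M.1 ρ 1 M.1.init := by
    haveI : Nonempty {M : FinMDP S A // IsPerturbation η M₀ M} := ⟨N⟩
    refine le_ciInf fun M => ?_
    have := le_val M₀ η b hb ρ hρ M.1 M.2 M₀.H le_rfl M₀.init
    simpa [rdpV, val, M.2.1, M.2.2.1] using this
  refine ⟨⟨⟨ρ, rfl⟩, ?_⟩, le_antisymm (upper ρ) lower⟩
  rintro _ ⟨ψ, rfl⟩
  exact (upper ψ).trans lower
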